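/- The set B_sgn = {α₁^a · α₂^b · α₃^c · γ₁^{2d+1} · γ₂^{2e} : a, b, d, e ∈ ℤ_{≥0}, c ∈ {0,1}} ∪ {α₁^a · α₂^b · α₃^c · γ₁^{2d} · γ₂^{2e+1} : a, b, d, e ∈ ℤ_{≥0}, c ∈ {0,1}} is a ℂ-vector space basis of (Q^{sgn})^{U_n}, the space of U_n-invariant polynomials f in Q satisfying τ·f = sgn(τ)·f for all τ ∈ S₃. -/

import Mathlib

open MvPolynomial

noncomputable section

/-- The polynomial ring `𝒫 = ℂ[x_{ij} : 1 ≤ i ≤ n, 1 ≤ j ≤ 3]` in the entries of an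
`n × 3` matrix of indeterminates. -/
abbrev P (n : ℕ) : Type := MvPolynomial (Fin n × Fin 3) ℂ

/-- The action of a matrix `g` on `𝒫`, given by `(g · f)(X) = f(gᵀ X)`;
on variables it sends `x_{ij} ↦ ∑ s g_{si} x_{sj}`. -/
def matAct (n : ℕ) (g : Matrix (Fin n) (Fin n) ℂ) : P n →ₐ[ℂ] P n :=
  aeval fun p : Fin n × Fin 3 => ∑ s : Fin n, C (g s p.1) * X (s, p.2)

/-- The action of `σ ∈ S₃` permuting columns: `x_{ij} ↦ x_{iσ(j)}`. -/
def permAct (n : ℕ) (σ : Equiv.Perm (Fin 3)) : P n →ₐ[ℂ] P n :=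
  aeval fun p : Fin n × Fin 3 => X (p.1, σ p.2)

/-- `g` is upper triangular with all diagonal entries equal to `1`, i.e. `g ∈ U_n`. -/
def IsUpperUni (n : ℕ) (g : Matrix (Fin n) (Fin n) ℂ) : Prop :=
  (∀ i, g i i = 1) ∧ ∀ i j, j < i → g i j = 0

/-- `f` is `U_n`-invariant. -/
def UInv (n : ℕ) (f : P n) : Prop :=
  ∀ g : Matrix (Fin n) (Fin n) ℂ, IsUpperUni n g → matAct n g f = f

/-- `f ∈ Q_m` : each monomial of `f` has total degree `m` in the column-`j` variables,
for each `j`. -/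
def InQm (n m : ℕ) (f : P n) : Prop :=
  ∀ d ∈ f.support, ∀ j : Fin 3, (∑ i : Fin n, d (i, j)) = m

/-- `f ∈ Q = ⊕ₘ Q_m` : each monomial of `f` has equal total degree in the three columns. -/
def InQ (n : ℕ) (f : P n) : Prop :=
  ∀ d ∈ f.support, ∀ j : Fin 3, (∑ i : Fin n, d (i, j)) = ∑ i : Fin n, d (i, (0 : Fin 3))

/-- The variable `x_{(i+1)(j+1)}`, `i j : Fin 3` (0-indexed rows and columns). -/
def Xe (n : ℕ) (hn : 3 ≤ n) (i j : Fin 3) : P n := X (Fin.castLE hn i, j)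

/-- `δ_{ij} = x_{1i} x_{2j} - x_{2i} x_{1j}` (0-indexed columns `i j : Fin 3`). -/
def del (n : ℕ) (hn : 3 ≤ n) (i j : Fin 3) : P n :=
  Xe n hn 0 i * Xe n hn 1 j - Xe n hn 1 i * Xe n hn 0 j

/-- `α₁ = x₁₁ x₁₂ x₁₃`. -/
def alpha1 (n : ℕ) (hn : 3 ≤ n) : P n := Xe n hn 0 0 * Xe n hn 0 1 * Xe n hn 0 2

/-- `β₂ = x₁₂ δ₁₃`. -/
def beta2 (n : ℕ) (hn : 3 ≤ n) : P n := Xe n hn 0 1 * del n hn 0 2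

/-- `β₃ = x₁₃ δ₁₂`. -/
def beta3 (n : ℕ) (hn : 3 ≤ n) : P n := Xe n hn 0 2 * del n hn 0 1

/-- `γ₁ = det (x_{ij})_{1 ≤ i,j ≤ 3}`. -/
def gamma1 (n : ℕ) (hn : 3 ≤ n) : P n := Matrix.det (Matrix.of fun i j : Fin 3 => Xe n hn i j)

/-- `γ₂ = δ₁₂ δ₁₃ δ₂₃`. -/
def gamma2 (n : ℕ) (hn : 3 ≤ n) : P n := del n hn 0 1 * del n hn 0 2 * del n hn 1 2

/-- `α₂ = β₂² + β₃² − β₂ β₃`. -/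
def alpha2 (n : ℕ) (hn : 3 ≤ n) : P n := beta2 n hn ^ 2 + beta3 n hn ^ 2 - beta2 n hn * beta3 n hn

/-- `α₃ = 2(β₂³ + β₃³) − 3(β₂² β₃ + β₂ β₃²)`. -/
def alpha3 (n : ℕ) (hn : 3 ≤ n) : P n :=
  2 * (beta2 n hn ^ 3 + beta3 n hn ^ 3) -
    3 * (beta2 n hn ^ 2 * beta3 n hn + beta2 n hn * beta3 n hn ^ 2)

/-- The family `B_sgn`: the left summand indexes `α₁^a α₂^b α₃^c γ₁^{2d+1} γ₂^{2e}`,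
the right summand indexes `α₁^a α₂^b α₃^c γ₁^{2d} γ₂^{2e+1}`,
with `a b d e : ℕ` and `c ∈ {0,1}`. -/
def Bsgn (n : ℕ) (hn : 3 ≤ n) :
    (ℕ × ℕ × Fin 2 × ℕ × ℕ) ⊕ (ℕ × ℕ × Fin 2 × ℕ × ℕ) → P n
  | Sum.inl (a, b, c, d, e) =>
      alpha1 n hn ^ a * alpha2 n hn ^ b * alpha3 n hn ^ (c : ℕ) *
        gamma1 n hn ^ (2 * d + 1) * gamma2 n hn ^ (2 * e)
  | Sum.inr (a, b, c, d, e) =>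
      alpha1 n hn ^ a * alpha2 n hn ^ b * alpha3 n hn ^ (c : ℕ) *
        gamma1 n hn ^ (2 * d) * gamma2 n hn ^ (2 * e + 1)

section Generators

variable {n : ℕ} (hn : 3 ≤ n)

lemma permAct_Xe (σ : Equiv.Perm (Fin 3)) (i j : Fin 3) :
    permAct n σ (Xe n hn i j) = Xe n hn i (σ j) := by
  simp [permAct, Xe]

lemma perm_fin_three_cases (σ : Equiv.Perm (Fin 3)) :
    (σ 0 = 0 ∧ σ 1 = 1 ∧ σ 2 = 2 ∧ Equiv.Perm.sign σ = 1) ∨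
    (σ 0 = 1 ∧ σ 1 = 2 ∧ σ 2 = 0 ∧ Equiv.Perm.sign σ = 1) ∨
    (σ 0 = 2 ∧ σ 1 = 0 ∧ σ 2 = 1 ∧ Equiv.Perm.sign σ = 1) ∨
    (σ 0 = 1 ∧ σ 1 = 0 ∧ σ 2 = 2 ∧ Equiv.Perm.sign σ = -1) ∨
    (σ 0 = 2 ∧ σ 1 = 1 ∧ σ 2 = 0 ∧ Equiv.Perm.sign σ = -1) ∨
    (σ 0 = 0 ∧ σ 1 = 2 ∧ σ 2 = 1 ∧ Equiv.Perm.sign σ = -1) := by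
  revert σ; decide

lemma permAct_generators (σ : Equiv.Perm (Fin 3)) :
    permAct n σ (alpha1 n hn) = alpha1 n hn ∧ permAct n σ (alpha2 n hn) = alpha2 n hn ∧
    permAct n σ (alpha3 n hn) = alpha3 n hn ∧
    permAct n σ (gamma1 n hn) = ((Equiv.Perm.sign σ : ℤ) : ℂ) • gamma1 n hn ∧
    permAct n σ (gamma2 n hn) = ((Equiv.Perm.sign σ : ℤ) : ℂ) • gamma2 n hn := by
  have two : permAct n σ 2 = 2 := map_ofNat _ 2
  have three : permAct n σ 3 = 3 := map_ofNat _ 3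
  rcases perm_fin_three_cases σ with ⟨h0, h1, h2, h⟩ | ⟨h0, h1, h2, h⟩ | ⟨h0, h1, h2, h⟩ |
    ⟨h0, h1, h2, h⟩ | ⟨h0, h1, h2, h⟩ | ⟨h0, h1, h2, h⟩ <;>
  refine ⟨?_, ?_, ?_, ?_, ?_⟩ <;>
  simp [alpha1, alpha2, alpha3, beta2, beta3, del, gamma1, gamma2, Matrix.det_fin_three,
    permAct_Xe, h0, h1, h2, h, two, three, -mul_eq_mul_right_iff,
    -mul_eq_mul_left_iff] <;> ring

lemma permAct_Bsgn (σ : Equiv.Perm (Fin 3)) (x) :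
    permAct n σ (Bsgn n hn x) = ((Equiv.Perm.sign σ : ℤ) : ℂ) • Bsgn n hn x := by
  obtain ⟨h1, h2, h3, h4, h5⟩ := permAct_generators hn σ
  rcases x with ⟨a, b, c, d, e⟩ | ⟨a, b, c, d, e⟩ <;>
  rcases Int.units_eq_one_or (Equiv.Perm.sign σ) with h | h <;>
  simp [Bsgn, h1, h2, h3, h4, h5, h, pow_succ, pow_mul]

/-- The weight of the variables in column `j`; the total weight of a monomial is the excess of its
degrees in columns two and three over its degree in column one. -/
def colDegree : Fin 3 → ℤ × ℤ := ![(-1, -1), (1, 0), (0, 1)]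

/-- The weights on the variables whose zero part is `Q`. -/
def colWeight (n : ℕ) (p : Fin n × Fin 3) : ℤ × ℤ := colDegree p.2

lemma inQ_iff {f : P n} : InQ n f ↔ IsWeightedHomogeneous (colWeight n) f 0 := by
  have key (d : Fin n × Fin 3 →₀ ℕ) : Finsupp.weight (colWeight n) d =
      (((∑ i, d (i, 1) : ℕ) : ℤ) - ((∑ i, d (i, 0) : ℕ) : ℤ),
        ((∑ i, d (i, 2) : ℕ) : ℤ) - ((∑ i, d (i, 0) : ℕ) : ℤ)) := by
    rw [Finsupp.weight_apply, Finsupp.sum_fintype _ _ (by simp), Fintype.sum_prod_type_right,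
      Fin.sum_univ_three]
    ext <;> simp [colWeight, colDegree, Prod.fst_sum, Prod.snd_sum] <;> ring
  unfold InQ IsWeightedHomogeneous
  simp only [mem_support_iff, key, Fin.forall_fin_succ, Prod.ext_iff, Prod.fst_zero, Prod.snd_zero]
  simp
  refine forall_congr' fun d => forall_congr' fun _ => ?_
  constructor
  · rintro ⟨h, h'⟩; zify at h h'; constructor <;> linarith
  · rintro ⟨h, h'⟩; zify; constructor <;> linarith

lemma isWeightedHomogeneous_Xe (i j : Fin 3) :
    IsWeightedHomogeneous (colWeight n) (Xe n hn i j) (colDegree j) :=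
  isWeightedHomogeneous_X ℂ (colWeight n) _

lemma isWeightedHomogeneous_del (i j : Fin 3) :
    IsWeightedHomogeneous (colWeight n) (del n hn i j) (colDegree i + colDegree j) := by
  have h1 := (isWeightedHomogeneous_Xe hn 0 i).mul (isWeightedHomogeneous_Xe hn 1 j)
  have h2 := (isWeightedHomogeneous_Xe hn 1 i).mul (isWeightedHomogeneous_Xe hn 0 j)
  exact (weightedHomogeneousSubmodule ℂ (colWeight n) _).sub_mem h1 h2

lemma isWeightedHomogeneous_of_eq {f : P n} {w w' : ℤ × ℤ}
    (h : IsWeightedHomogeneous (colWeight n) f w) (hw : w = w') :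
    IsWeightedHomogeneous (colWeight n) f w' := hw ▸ h

lemma isWeightedHomogeneous_alpha1 : IsWeightedHomogeneous (colWeight n) (alpha1 n hn) 0 :=
  isWeightedHomogeneous_of_eq (((isWeightedHomogeneous_Xe hn 0 0).mul
    (isWeightedHomogeneous_Xe hn 0 1)).mul (isWeightedHomogeneous_Xe hn 0 2)) (by decide)

lemma isWeightedHomogeneous_beta2 : IsWeightedHomogeneous (colWeight n) (beta2 n hn) 0 :=
  isWeightedHomogeneous_of_eq ((isWeightedHomogeneous_Xe hn 0 1).mul
    (isWeightedHomogeneous_del hn 0 2)) (by decide)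

lemma isWeightedHomogeneous_beta3 : IsWeightedHomogeneous (colWeight n) (beta3 n hn) 0 :=
  isWeightedHomogeneous_of_eq ((isWeightedHomogeneous_Xe hn 0 2).mul
    (isWeightedHomogeneous_del hn 0 1)) (by decide)

lemma isWeightedHomogeneous_gamma2 : IsWeightedHomogeneous (colWeight n) (gamma2 n hn) 0 :=
  isWeightedHomogeneous_of_eq (((isWeightedHomogeneous_del hn 0 1).mul
    (isWeightedHomogeneous_del hn 0 2)).mul (isWeightedHomogeneous_del hn 1 2)) (by decide)

lemma gamma1_eq : gamma1 n hn =
    Xe n hn 2 0 * del n hn 1 2 - Xe n hn 2 1 * del n hn 0 2 + Xe n hn 2 2 * del n hn 0 1 := by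
  simp only [gamma1, del, Matrix.det_fin_three, Matrix.of_apply]
  ring

/-- The subalgebra `Q` of the polynomial ring. -/
def subalgQ (n : ℕ) : Subalgebra ℂ (P n) where
  carrier := {f | IsWeightedHomogeneous (colWeight n) f 0}
  mul_mem' h h' := isWeightedHomogeneous_of_eq (h.mul h') (add_zero 0)
  add_mem' h h' := h.add h'
  algebraMap_mem' c := isWeightedHomogeneous_C _ c

lemma isWeightedHomogeneous_gamma1 : IsWeightedHomogeneous (colWeight n) (gamma1 n hn) 0 := by
  rw [gamma1_eq]
  refine (weightedHomogeneousSubmodule ℂ (colWeight n) _).add_mem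
    ((weightedHomogeneousSubmodule ℂ (colWeight n) _).sub_mem ?_ ?_) ?_
  · exact isWeightedHomogeneous_of_eq ((isWeightedHomogeneous_Xe hn 2 0).mul
      (isWeightedHomogeneous_del hn 1 2)) (by decide)
  · exact isWeightedHomogeneous_of_eq ((isWeightedHomogeneous_Xe hn 2 1).mul
      (isWeightedHomogeneous_del hn 0 2)) (by decide)
  · exact isWeightedHomogeneous_of_eq ((isWeightedHomogeneous_Xe hn 2 2).mul
      (isWeightedHomogeneous_del hn 0 1)) (by decide)

/-- A subalgebra containing the generators contains the family `B_sgn`. -/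
lemma Bsgn_mem (A : Subalgebra ℂ (P n)) (h1 : alpha1 n hn ∈ A) (h2 : beta2 n hn ∈ A)
    (h3 : beta3 n hn ∈ A) (h4 : gamma1 n hn ∈ A) (h5 : gamma2 n hn ∈ A) (x) :
    Bsgn n hn x ∈ A := by
  have two : (2 : P n) ∈ A := ofNat_mem A 2
  have three : (3 : P n) ∈ A := ofNat_mem A 3
  have h6 : alpha2 n hn ∈ A :=
    sub_mem (add_mem (pow_mem h2 _) (pow_mem h3 _)) (mul_mem h2 h3)
  have h7 : alpha3 n hn ∈ A :=
    sub_mem (mul_mem two (add_mem (pow_mem h2 _) (pow_mem h3 _)))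
      (mul_mem three (add_mem (mul_mem (pow_mem h2 _) h3) (mul_mem h2 (pow_mem h3 _))))
  rcases x with ⟨a, b, c, d, e⟩ | ⟨a, b, c, d, e⟩ <;>
  exact mul_mem (mul_mem (mul_mem (mul_mem (pow_mem h1 _) (pow_mem h6 _)) (pow_mem h7 _))
    (pow_mem h4 _)) (pow_mem h5 _)

lemma inQ_Bsgn (x) : InQ n (Bsgn n hn x) :=
  inQ_iff.2 <| Bsgn_mem hn (subalgQ n) (isWeightedHomogeneous_alpha1 hn)
    (isWeightedHomogeneous_beta2 hn) (isWeightedHomogeneous_beta3 hn)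
    (isWeightedHomogeneous_gamma1 hn) (isWeightedHomogeneous_gamma2 hn) x

lemma sum_eq_sum_castLE {R : Type*} [AddCommMonoid R] (h : Fin n → R)
    (h0 : ∀ s : Fin n, 3 ≤ (s : ℕ) → h s = 0) : ∑ s, h s = ∑ s : Fin 3, h (Fin.castLE hn s) := by
  symm
  refine Finset.sum_of_injOn (Fin.castLE hn) (Fin.castLE_injective hn).injOn (by simp) ?_
    (fun _ _ => rfl)
  intro s _ hs
  refine h0 s ?_
  by_contra hlt
  exact hs ⟨⟨s, by omega⟩, by simp, rfl⟩

/-- A unitriangular matrix adds multiples of earlier rows to each row. -/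
lemma matAct_Xe {g : Matrix (Fin n) (Fin n) ℂ} (hg : IsUpperUni n g) (j : Fin 3) :
    matAct n g (Xe n hn 0 j) = Xe n hn 0 j ∧
    matAct n g (Xe n hn 1 j) =
      C (g (Fin.castLE hn 0) (Fin.castLE hn 1)) * Xe n hn 0 j + Xe n hn 1 j ∧
    matAct n g (Xe n hn 2 j) = C (g (Fin.castLE hn 0) (Fin.castLE hn 2)) * Xe n hn 0 j +
      C (g (Fin.castLE hn 1) (Fin.castLE hn 2)) * Xe n hn 1 j + Xe n hn 2 j := by
  have key (i : Fin 3) : matAct n g (Xe n hn i j) =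
      ∑ s : Fin 3, C (g (Fin.castLE hn s) (Fin.castLE hn i)) * Xe n hn s j := by
    simp only [matAct, Xe, aeval_X]
    refine sum_eq_sum_castLE hn _ fun s hs => ?_
    rw [hg.2 s (Fin.castLE hn i) (by simp [Fin.lt_def]; omega), C_0, zero_mul]
  have h10 := hg.2 (Fin.castLE hn 1) (Fin.castLE hn 0) (by simp [Fin.lt_def])
  have h20 := hg.2 (Fin.castLE hn 2) (Fin.castLE hn 0) (by simp [Fin.lt_def])
  have h21 := hg.2 (Fin.castLE hn 2) (Fin.castLE hn 1) (by simp [Fin.lt_def])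
  refine ⟨?_, ?_, ?_⟩ <;> simp only [key, Fin.sum_univ_three, hg.1, h10, h20, h21] <;> simp

lemma uInv_Bsgn (x) : UInv n (Bsgn n hn x) := by
  intro g hg
  have h0 := fun j => (matAct_Xe hn hg j).1
  have h1 := fun j => (matAct_Xe hn hg j).2.1
  have h2 := fun j => (matAct_Xe hn hg j).2.2
  refine Bsgn_mem hn (AlgHom.equalizer (matAct n g) (AlgHom.id ℂ (P n))) ?_ ?_ ?_ ?_ ?_ x <;>
  simp only [AlgHom.mem_equalizer, AlgHom.id_apply, alpha1, beta2, beta3, gamma1_eq, gamma2, del,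
    map_add, map_sub, map_mul, h0, h1, h2] <;> ring

end Generators

section Independence

variable {n : ℕ} (hn : 3 ≤ n)

/-- The index type of the family `B_sgn`. -/
abbrev SgnIndex : Type := (ℕ × ℕ × Fin 2 × ℕ × ℕ) ⊕ (ℕ × ℕ × Fin 2 × ℕ × ℕ)

/-- The exponent of `α₁`. -/
def alphaDegree : SgnIndex → ℕ := Sum.elim Prod.fst Prod.fst

/-- Increasing the exponent of `α₁` by one. -/
def alphaSucc : SgnIndex → SgnIndex := Sum.map (Prod.map Nat.succ id) (Prod.map Nat.succ id)

lemma alphaSucc_injective : Function.Injective alphaSucc :=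
  ((Nat.succ_injective.prodMap Function.injective_id).sumMap
    (Nat.succ_injective.prodMap Function.injective_id))

lemma alphaDegree_alphaSucc (i : SgnIndex) : alphaDegree (alphaSucc i) = alphaDegree i + 1 := by
  rcases i with i | i <;> rfl

lemma mem_range_alphaSucc {i : SgnIndex} (hi : alphaDegree i ≠ 0) : i ∈ Set.range alphaSucc := by
  rcases i with ⟨_ | a, x⟩ | ⟨_ | a, x⟩
  · exact absurd rfl hi
  · exact ⟨Sum.inl (a, x), rfl⟩
  · exact absurd rfl hi
  · exact ⟨Sum.inr (a, x), rfl⟩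

lemma Bsgn_alphaSucc (i : SgnIndex) :
    Bsgn n hn (alphaSucc i) = alpha1 n hn * Bsgn n hn i := by
  rcases i with ⟨a, b, c, d, e⟩ | ⟨a, b, c, d, e⟩ <;>
  simp only [alphaSucc, Sum.map_inl, Sum.map_inr, Prod.map_apply, id_eq, Bsgn, pow_succ] <;> ring

/-- The exponent vector of the specialization of an element of `B_sgn` without factor `α₁`. -/
def specExponent : SgnIndex → Fin 3 →₀ ℕ
  | Sum.inl (_, b, c, d, e) => Finsupp.single 0 (2 * b + 3 * c + (2 * d + 1) + 4 * e) +
      Finsupp.single 1 (2 * d + 1) + Finsupp.single 2 (2 * e)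
  | Sum.inr (_, b, c, d, e) => Finsupp.single 0 (2 * b + 3 * c + 2 * d + 2 * (2 * e + 1)) +
      Finsupp.single 1 (2 * d) + Finsupp.single 2 (2 * e + 1)

/-- The coefficient of the specialization of an element of `B_sgn` without factor `α₁`. -/
def specCoeff : SgnIndex → ℂ
  | Sum.inl (_, _, c, _, _) => 2 ^ (c : ℕ)
  | Sum.inr (_, _, c, _, _) => 2 ^ (c : ℕ)

lemma specCoeff_ne_zero (i : SgnIndex) : specCoeff i ≠ 0 := by
  rcases i with ⟨a, b, c, d, e⟩ | ⟨a, b, c, d, e⟩ <;> simp [specCoeff]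

lemma specExponent_injOn {i j : SgnIndex} (hi : alphaDegree i = 0) (hj : alphaDegree j = 0)
    (h : specExponent i = specExponent j) : i = j := by
  have h0 := DFunLike.congr_fun h 0
  have h1 := DFunLike.congr_fun h 1
  have h2 := DFunLike.congr_fun h 2
  rcases i with ⟨a, b, c, d, e⟩ | ⟨a, b, c, d, e⟩ <;>
  rcases j with ⟨a', b', c', d', e'⟩ | ⟨a', b', c', d', e'⟩ <;>
  simp [specExponent, alphaDegree] at h0 h1 h2 hi hj ⊢ <;>
  omega

/-- The specialization of the matrix of variables to a matrix with vanishing corner entry. -/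
def specialize (n : ℕ) : P n →ₐ[ℂ] MvPolynomial (Fin 3) ℂ :=
  aeval fun p => if h : (p.1 : ℕ) < 3 then
    (!![0, 1, 1; X 0, 0, X 2; 0, X 1, 0] : Matrix (Fin 3) (Fin 3) _) ⟨p.1, h⟩ p.2 else 0

lemma specialize_Xe (i j : Fin 3) : specialize n (Xe n hn i j) =
    (!![0, 1, 1; X 0, 0, X 2; 0, X 1, 0] : Matrix (Fin 3) (Fin 3) (MvPolynomial (Fin 3) ℂ)) i j := by
  simp [specialize, Xe]

lemma specialize_alpha1 : specialize n (alpha1 n hn) = 0 := by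
  simp [alpha1, specialize_Xe]

lemma specialize_Bsgn (i : SgnIndex) : specialize n (Bsgn n hn i) =
    if alphaDegree i = 0 then monomial (specExponent i) (specCoeff i) else 0 := by
  split_ifs with h
  · have two : specialize n 2 = 2 := map_ofNat _ 2
    have three : specialize n 3 = 3 := map_ofNat _ 3
    have h2 : specialize n (alpha2 n hn) = X 0 ^ 2 := by
      simp [alpha2, beta2, beta3, del, specialize_Xe]; ring
    have h3 : specialize n (alpha3 n hn) = C 2 * X 0 ^ 3 := by
      rw [show (C 2 : MvPolynomial (Fin 3) ℂ) = 2 from map_ofNat _ 2]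
      simp [alpha3, beta2, beta3, del, specialize_Xe, two, three]; ring
    have h4 : specialize n (gamma1 n hn) = X 0 * X 1 := by
      simp [gamma1_eq, del, specialize_Xe]; ring
    have h5 : specialize n (gamma2 n hn) = X 0 ^ 2 * X 2 := by
      simp [gamma2, del, specialize_Xe]; ring
    have key (w : ℂ) (p q r : ℕ) : monomial (Finsupp.single 0 p + Finsupp.single 1 q +
        Finsupp.single 2 r) w = C w * X 0 ^ p * X 1 ^ q * X (2 : Fin 3) ^ r := by
      simp [X_pow_eq_monomial, C_mul_monomial, monomial_mul]
    rcases i with ⟨a, b, c, d, e⟩ | ⟨a, b, c, d, e⟩ <;>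
    · obtain rfl : a = 0 := h
      simp only [Bsgn, specExponent, specCoeff, key, map_mul, map_pow, h2, h3, h4, h5]
      ring
  · obtain ⟨j, rfl⟩ := mem_range_alphaSucc h
    rw [Bsgn_alphaSucc, map_mul, specialize_alpha1, zero_mul]

lemma coeff_specialize_linearCombination (l : SgnIndex →₀ ℂ) {i : SgnIndex}
    (hi : alphaDegree i = 0) :
    coeff (specExponent i) (specialize n (Finsupp.linearCombination ℂ (Bsgn n hn) l)) =
      l i * specCoeff i := by
  rw [Finsupp.linearCombination_apply, Finsupp.sum, map_sum, coeff_sum,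
    Finset.sum_eq_single i]
  · simp [specialize_Bsgn, hi]
  · intro j _ hj
    rw [map_smul, coeff_smul, specialize_Bsgn]
    split_ifs with h
    · rw [coeff_monomial, if_neg fun e => hj (specExponent_injOn h hi e), smul_zero]
    · simp
  · intro h
    simp [Finsupp.notMem_support_iff.1 h]

/-- A combination of `B_sgn` killed by the specialization is a multiple of `α₁`, termwise. -/
lemma exists_mapDomain_alphaSucc {l : SgnIndex →₀ ℂ}
    (h : specialize n (Finsupp.linearCombination ℂ (Bsgn n hn) l) = 0) :
    ∃ l' : SgnIndex →₀ ℂ, l'.mapDomain alphaSucc = l ∧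
      Finsupp.linearCombination ℂ (Bsgn n hn) l =
        alpha1 n hn * Finsupp.linearCombination ℂ (Bsgn n hn) l' := by
  have hl (i) (hi : alphaDegree i = 0) : l i = 0 := by
    have := coeff_specialize_linearCombination hn l hi
    rw [h, coeff_zero] at this
    exact (mul_eq_zero.1 this.symm).resolve_right (specCoeff_ne_zero i)
  have hmap := Finsupp.mapDomain_comapDomain alphaSucc alphaSucc_injective l fun i hi =>
    mem_range_alphaSucc fun h0 => Finsupp.mem_support_iff.1 hi (hl i h0)
  refine ⟨_, hmap, ?_⟩
  conv_lhs => rw [← hmap]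
  rw [Finsupp.linearCombination_mapDomain, Finsupp.linearCombination_apply,
    Finsupp.linearCombination_apply, Finsupp.sum, Finsupp.sum, Finset.mul_sum]
  refine Finset.sum_congr rfl fun i _ => ?_
  rw [Function.comp_apply, Bsgn_alphaSucc, mul_smul_comm]

lemma Xe_ne_zero (i j : Fin 3) : Xe n hn i j ≠ 0 := X_ne_zero _

lemma alpha1_ne_zero : alpha1 n hn ≠ 0 :=
  mul_ne_zero (mul_ne_zero (Xe_ne_zero hn 0 0) (Xe_ne_zero hn 0 1)) (Xe_ne_zero hn 0 2)

lemma linearIndependent_Bsgn : LinearIndependent ℂ (Bsgn n hn) := by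
  rw [linearIndependent_iff]
  suffices ∀ N : ℕ, ∀ l, Finsupp.linearCombination ℂ (Bsgn n hn) l = 0 →
      ∀ i, alphaDegree i = N → l i = 0 from fun l hl => Finsupp.ext fun i => this _ l hl i rfl
  intro N
  induction N with
  | zero =>
    intro l hl i hi
    have := coeff_specialize_linearCombination hn l hi
    rw [hl, map_zero, coeff_zero] at this
    exact (mul_eq_zero.1 this.symm).resolve_right (specCoeff_ne_zero i)
  | succ N ih =>
    intro l hl i hi
    obtain ⟨l', rfl, h⟩ := exists_mapDomain_alphaSucc hn (l := l) (by rw [hl, map_zero])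
    rw [hl] at h
    obtain ⟨j, rfl⟩ := mem_range_alphaSucc (i := i) (by omega)
    rw [Finsupp.mapDomain_apply alphaSucc_injective]
    rw [alphaDegree_alphaSucc] at hi
    exact ih l' ((mul_eq_zero.1 h.symm).resolve_left (alpha1_ne_zero hn)) j (by omega)

/-- The span of `B_sgn`. -/
abbrev spanB : Submodule ℂ (P n) := Submodule.span ℂ (Set.range (Bsgn n hn))

lemma mem_spanB_of_alpha1_mul {f : P n} (h : alpha1 n hn * f ∈ spanB hn) : f ∈ spanB hn := by
  obtain ⟨l, hl⟩ := Finsupp.mem_span_range_iff_exists_finsupp.1 h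
  change Finsupp.linearCombination ℂ (Bsgn n hn) l = _ at hl
  obtain ⟨l', -, h'⟩ := exists_mapDomain_alphaSucc hn (l := l)
    (by rw [hl, map_mul, specialize_alpha1, zero_mul])
  rw [hl] at h'
  rw [mul_left_cancel₀ (alpha1_ne_zero hn) h']
  exact Finsupp.mem_span_range_iff_exists_finsupp.2 ⟨l', rfl⟩

lemma mem_spanB_of_alpha1_pow_mul {f : P n} (k : ℕ) (h : alpha1 n hn ^ k * f ∈ spanB hn) :
    f ∈ spanB hn := by
  induction k with
  | zero => simpa using h
  | succ k ih => exact ih (mem_spanB_of_alpha1_mul hn (by rwa [← mul_assoc, ← pow_succ']))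

end Independence

section NormalForm

variable {n : ℕ} (hn : 3 ≤ n)

/-- The normal form, under unitriangular row operations and determinant one column scalings, of a
matrix with `α₁ = a`, `β₂ = b`, `β₃ = c`, `γ₁ = g`. -/
def normalForm (n : ℕ) (a b c g : ℂ) : Fin n × Fin 3 → ℂ := fun p =>
  if h : (p.1 : ℕ) < 3 then
    (!![a, 1, 1; 0, c / a, b / a; 0, 0, g / c] : Matrix (Fin 3) (Fin 3) ℂ) ⟨p.1, h⟩ p.2 else 0

lemma eval_normalForm_Xe (a b c g : ℂ) (i j : Fin 3) : eval (normalForm n a b c g) (Xe n hn i j) =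
    (!![a, 1, 1; 0, c / a, b / a; 0, 0, g / c] : Matrix (Fin 3) (Fin 3) ℂ) i j := by
  simp [normalForm, Xe]

/-- The algebra map sending the four variables to `α₁, β₂, β₃, γ₁`. -/
def genHom : MvPolynomial (Fin 4) ℂ →ₐ[ℂ] P n :=
  aeval ![alpha1 n hn, beta2 n hn, beta3 n hn, gamma1 n hn]

lemma eval_genHom (M : Fin n × Fin 3 → ℂ) (H : MvPolynomial (Fin 4) ℂ) :
    eval M (genHom hn H) = eval ![eval M (alpha1 n hn), eval M (beta2 n hn), eval M (beta3 n hn),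
      eval M (gamma1 n hn)] H := by
  induction H using MvPolynomial.induction_on with
  | C r => simp [genHom]
  | add p q hp hq => simp only [map_add, hp, hq]
  | mul_X p i hp =>
    rw [map_mul, map_mul, hp, map_mul, eval_X]
    congr 1
    fin_cases i <;> simp [genHom]

lemma genHom_injective : Function.Injective (genHom hn) := by
  rw [injective_iff_map_eq_zero]
  intro H hH
  have h : H * (X 0 * X 2) = 0 := by
    refine MvPolynomial.funext fun v => ?_
    rw [map_mul, map_mul, eval_X, eval_X, map_zero]
    by_cases h0 : v 0 = 0
    · simp [h0]
    by_cases h2 : v 2 = 0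
    · simp [h2]
    have := eval_genHom hn (normalForm n (v 0) (v 1) (v 2) (v 3)) H
    rw [hH, map_zero] at this
    have hv : ![eval (normalForm n (v 0) (v 1) (v 2) (v 3)) (alpha1 n hn),
        eval (normalForm n (v 0) (v 1) (v 2) (v 3)) (beta2 n hn),
        eval (normalForm n (v 0) (v 1) (v 2) (v 3)) (beta3 n hn),
        eval (normalForm n (v 0) (v 1) (v 2) (v 3)) (gamma1 n hn)] = v := by
      funext i
      fin_cases i <;>
      simp [alpha1, beta2, beta3, gamma1_eq, del, eval_normalForm_Xe] <;> field_simp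
    rw [← hv, ← this, zero_mul]
  exact (mul_eq_zero.1 h).resolve_right (mul_ne_zero (X_ne_zero _) (X_ne_zero _))

lemma eval_scale {f : P n} (hf : InQ n f) {t : Fin 3 → ℂ} (ht : t 0 * t 1 * t 2 = 1)
    (M : Fin n × Fin 3 → ℂ) : eval (fun p => M p * t p.2) f = eval M f := by
  rw [eval_eq', eval_eq']
  refine Finset.sum_congr rfl fun d hd => ?_
  congr 1
  simp only [mul_pow, Finset.prod_mul_distrib]
  convert mul_one _
  rw [Fintype.prod_prod_type_right, Fin.prod_univ_three]
  simp only [Finset.prod_pow_eq_pow_sum]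
  rw [hf d hd 1, hf d hd 2, ← mul_pow, ← mul_pow, ht, one_pow]

lemma eval_matAct (g : Matrix (Fin n) (Fin n) ℂ) (M : Fin n × Fin 3 → ℂ) (f : P n) :
    eval M (matAct n g f) = eval (fun p => ∑ s, g s p.1 * M (s, p.2)) f := by
  induction f using MvPolynomial.induction_on with
  | C r => simp [matAct]
  | add p q hp hq => simp only [map_add, hp, hq]
  | mul_X p i hp => rw [map_mul, map_mul, hp]; simp [matAct]

/-- On a generic matrix, an element of `Q^{U_n}` takes the same value as on the normal form. -/
lemma eval_eq_eval_normalForm {f : P n} (hf : InQ n f) (hU : UInv n f) (M : Fin n × Fin 3 → ℂ)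
    (ha : eval M (alpha1 n hn) ≠ 0) (hc : eval M (beta3 n hn) ≠ 0)
    (hg : eval M (gamma1 n hn) ≠ 0) :
    eval M f = eval (normalForm n (eval M (alpha1 n hn)) (eval M (beta2 n hn))
      (eval M (beta3 n hn)) (eval M (gamma1 n hn))) f := by
  set a := eval M (alpha1 n hn) with ha'
  set b := eval M (beta2 n hn) with hb'
  set c := eval M (beta3 n hn) with hc'
  set g := eval M (gamma1 n hn) with hg'
  simp only [alpha1, beta2, beta3, gamma1_eq, del, map_mul, map_add, map_sub, Xe, eval_X]
    at ha' hb' hc' hg'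
  set x : Fin 3 → ℂ := fun j => M (Fin.castLE hn 0, j)
  have hx0 : x 0 ≠ 0 := fun h => ha (by rw [ha']; simp [x] at h; simp [h])
  have hx1 : x 1 ≠ 0 := fun h => ha (by rw [ha']; simp [x] at h; simp [h])
  have hx2 : x 2 ≠ 0 := fun h => ha (by rw [ha']; simp [x] at h; simp [h])
  let c0 : Fin n → ℂ := fun i => M (i, 0) / x 0
  let c1 : Fin n → ℂ := fun i => (M (i, 1) / x 1 - c0 i) * a / c
  let c2 : Fin n → ℂ := fun i => (M (i, 2) / x 2 - c0 i - c1 i * b / a) * c / g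
  let u : Matrix (Fin n) (Fin n) ℂ := fun s i =>
    if (s : ℕ) = 0 then c0 i else if (s : ℕ) = 1 then c1 i else if (s : ℕ) = 2 then c2 i
    else if s = i then 1 else 0
  have e0 : c0 (Fin.castLE hn 0) = 1 := div_self hx0
  have e10 : c1 (Fin.castLE hn 0) = 0 := by
    simp only [c1, e0]; rw [show M (Fin.castLE hn 0, 1) = x 1 from rfl, div_self hx1]; simp
  have e20 : c2 (Fin.castLE hn 0) = 0 := by
    simp only [c2, e0, e10]; rw [show M (Fin.castLE hn 0, 2) = x 2 from rfl, div_self hx2]; simp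
  have e11 : c1 (Fin.castLE hn 1) = 1 := by
    simp only [c1, c0]
    rw [div_eq_one_iff_eq hc, hc', ha']
    field_simp
    simp only [x]
    ring
  have e21 : c2 (Fin.castLE hn 1) = 0 := by
    simp only [c2, e11]
    simp only [c0]
    convert_to (M (Fin.castLE hn 1, 2) / x 2 - M (Fin.castLE hn 1, 0) / x 0 - b / a) * c / g = 0
    · ring
    rw [hb', ha']
    change (_ / x 2 - _ / x 0 - (x 1 * (x 0 * _ - _ * x 2)) / (x 0 * x 1 * x 2)) * c / g = 0
    field_simp
    ring
  have e22 : c2 (Fin.castLE hn 2) = 1 := by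
    rw [div_eq_one_iff_eq hg]
    have : c1 (Fin.castLE hn 2) * c = (M (Fin.castLE hn 2, 1) / x 1 - c0 (Fin.castLE hn 2)) * a :=
      div_mul_cancel₀ _ hc
    have : (M (Fin.castLE hn 2, 2) / x 2 - c0 (Fin.castLE hn 2) - c1 (Fin.castLE hn 2) * b / a) * c
      = (M (Fin.castLE hn 2, 2) / x 2 - c0 (Fin.castLE hn 2)) * c -
        (M (Fin.castLE hn 2, 1) / x 1 - c0 (Fin.castLE hn 2)) * b := by
      rw [sub_mul, div_mul_eq_mul_div, mul_right_comm, this]; field_simp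
    rw [this, hg', hc', hb']
    change (_ / x 2 - _ / x 0) * (x 2 * (x 0 * _ - _ * x 1)) -
      (_ / x 1 - _ / x 0) * (x 1 * (x 0 * _ - _ * x 2)) = _ * (x 1 * _ - _ * x 2) -
        _ * (x 0 * _ - _ * x 2) + _ * (x 0 * _ - _ * x 1)
    field_simp
    ring
  have hcases (i : Fin n) : i = Fin.castLE hn 0 ∨ i = Fin.castLE hn 1 ∨ i = Fin.castLE hn 2 ∨
      3 ≤ (i : ℕ) := by
    simp only [Fin.ext_iff, Fin.val_castLE]
    simp
    omega
  have hu : IsUpperUni n u := by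
    constructor
    · intro i
      rcases hcases i with rfl | rfl | rfl | hi
      · simpa [u] using e0
      · simpa [u] using e11
      · simpa [u] using e22
      · simp only [u]
        rw [if_neg (by omega), if_neg (by omega), if_neg (by omega), if_pos trivial]
    · intro i j hij
      rcases hcases i with rfl | rfl | rfl | hi
      · simp [Fin.lt_def] at hij
      · obtain rfl : j = Fin.castLE hn 0 := by
          simp [Fin.lt_def, Fin.ext_iff] at hij ⊢; omega
        simpa [u] using e10
      · obtain rfl | rfl : j = Fin.castLE hn 0 ∨ j = Fin.castLE hn 1 := by
          simp [Fin.lt_def, Fin.ext_iff] at hij ⊢; omega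
        · simpa [u] using e20
        · simpa [u] using e21
      · simp only [u]
        rw [if_neg (by omega), if_neg (by omega), if_neg (by omega), if_neg hij.ne']
  let t : Fin 3 → ℂ := ![1 / (x 1 * x 2), x 1, x 2]
  have ht : t 0 * t 1 * t 2 = 1 := by simp [t]; field_simp
  conv_rhs => rw [← hU u hu, eval_matAct, ← eval_scale hf ht]
  congr 1
  congr 1
  ext ⟨i, j⟩
  rw [sum_eq_sum_castLE hn _ fun s hs => by simp [normalForm, not_lt.2 hs], Fin.sum_univ_three]
  have h0 : u (Fin.castLE hn 0) i = c0 i := by simp [u]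
  have h1 : u (Fin.castLE hn 1) i = c1 i := by simp [u]
  have h2 : u (Fin.castLE hn 2) i = c2 i := by simp [u]
  have ht0 : a = x 0 * x 1 * x 2 := ha'
  rw [h0, h1, h2]
  fin_cases j
  · simp [normalForm, t, ht0, c0]
    field_simp
  · simp [normalForm, t, c1]
    field_simp
    ring
  · simp [normalForm, t, c2]
    field_simp
    ring

end NormalForm

section Saturation

variable {n : ℕ} (hn : 3 ≤ n)

lemma exists_eval_normalForm_eq (f : P n) : ∃ (k : ℕ) (H : MvPolynomial (Fin 4) ℂ),
    ∀ a b c g : ℂ, a ≠ 0 → c ≠ 0 →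
      (a * c) ^ k * eval (normalForm n a b c g) f = eval ![a, b, c, g] H := by
  induction f using MvPolynomial.induction_on with
  | C r => exact ⟨0, C r, fun a b c g _ _ => by simp⟩
  | add p q hp hq =>
    obtain ⟨k, H, h⟩ := hp
    obtain ⟨k', H', h'⟩ := hq
    refine ⟨k + k', (X 0 * X 2) ^ k' * H + (X 0 * X 2) ^ k * H', fun a b c g ha hc => ?_⟩
    simp only [map_add, map_mul, map_pow, ← h a b c g ha hc, ← h' a b c g ha hc]
    simp
    ring
  | mul_X p i hp =>
    obtain ⟨k, H, h⟩ := hp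
    obtain ⟨E, hE⟩ : ∃ E : MvPolynomial (Fin 4) ℂ, ∀ a b c g : ℂ, a ≠ 0 → c ≠ 0 →
        a * c * normalForm n a b c g i = eval ![a, b, c, g] E := by
      obtain ⟨i, j⟩ := i
      by_cases hi : (i : ℕ) < 3
      · refine ⟨(!![X 0 * X 0 * X 2, X 0 * X 2, X 0 * X 2; 0, X 2 * X 2, X 1 * X 2;
          0, 0, X 0 * X 3] : Matrix (Fin 3) (Fin 3) (MvPolynomial (Fin 4) ℂ)) ⟨i, hi⟩ j,
          fun a b c g ha hc => ?_⟩
        simp only [normalForm, hi, dif_pos]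
        generalize (⟨i, hi⟩ : Fin 3) = i'
        fin_cases i' <;> fin_cases j <;> simp <;> field_simp
      · exact ⟨0, fun a b c g _ _ => by simp [normalForm, hi]⟩
    refine ⟨k + 1, H * E, fun a b c g ha hc => ?_⟩
    rw [map_mul, map_mul, eval_X, ← h a b c g ha hc, ← hE a b c g ha hc]
    ring

lemma beta3_ne_zero : beta3 n hn ≠ 0 := by
  have := (genHom_injective hn).ne (X_ne_zero (R := ℂ) (2 : Fin 4))
  simpa [genHom] using this

lemma gamma1_ne_zero : gamma1 n hn ≠ 0 := by
  have := (genHom_injective hn).ne (X_ne_zero (R := ℂ) (3 : Fin 4))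
  simpa [genHom] using this

lemma exists_mul_beta3_pow_eq_genHom {f : P n} (hf : InQ n f) (hU : UInv n f) :
    ∃ (k : ℕ) (H : MvPolynomial (Fin 4) ℂ),
      (alpha1 n hn * beta3 n hn) ^ k * f = genHom hn H := by
  obtain ⟨k, H, h⟩ := exists_eval_normalForm_eq f
  refine ⟨k, H, ?_⟩
  have hne : alpha1 n hn * beta3 n hn * gamma1 n hn ≠ 0 :=
    mul_ne_zero (mul_ne_zero (alpha1_ne_zero hn) (beta3_ne_zero hn)) (gamma1_ne_zero hn)
  refine mul_right_cancel₀ hne (MvPolynomial.funext fun M => ?_)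
  simp only [map_mul, map_pow, eval_genHom]
  by_cases ha : eval M (alpha1 n hn) = 0
  · simp [ha]
  by_cases hc : eval M (beta3 n hn) = 0
  · simp [hc]
  by_cases hg : eval M (gamma1 n hn) = 0
  · simp [hg]
  rw [← h _ _ _ _ ha hc, ← eval_eq_eval_normalForm hn hf hU M ha hc hg]

lemma permAct_swap_generators :
    permAct n (Equiv.swap 1 2) (beta2 n hn) = beta3 n hn ∧
    permAct n (Equiv.swap 1 2) (beta3 n hn) = beta2 n hn ∧
    permAct n (Equiv.swap 1 2) (gamma1 n hn) = - gamma1 n hn := by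
  refine ⟨?_, ?_, ?_⟩
  · simp [beta2, beta3, del, permAct_Xe, Equiv.swap_apply_def]
  · simp [beta2, beta3, del, permAct_Xe, Equiv.swap_apply_def]
  · simp [(permAct_generators hn (Equiv.swap 1 2)).2.2.2.1]

lemma permAct_swap_genHom (H : MvPolynomial (Fin 4) ℂ) :
    permAct n (Equiv.swap 1 2) (genHom hn H) =
      genHom hn (aeval ![X 0, X 2, X 1, -X 3] H) := by
  have : (permAct n (Equiv.swap 1 2)).comp (genHom hn) =
      (genHom hn).comp (aeval ![X 0, X 2, X 1, -X 3]) := by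
    obtain ⟨h1, h2, h3⟩ := permAct_swap_generators hn
    refine MvPolynomial.algHom_ext fun i => ?_
    fin_cases i <;> simp [genHom, h1, h2, h3, (permAct_generators hn _).1]
  exact DFunLike.congr_fun this H

lemma exists_mul_eq_genHom {f : P n} (hf : InQ n f) (hU : UInv n f)
    (hs : permAct n (Equiv.swap 1 2) f = -f) :
    ∃ (k : ℕ) (H : MvPolynomial (Fin 4) ℂ), alpha1 n hn ^ k * f = genHom hn H := by
  obtain ⟨k, H, h⟩ := exists_mul_beta3_pow_eq_genHom hn hf hU
  obtain ⟨h1, h2, h3⟩ := permAct_swap_generators hn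
  have h' := congrArg (permAct n (Equiv.swap 1 2)) h
  rw [permAct_swap_genHom, map_mul, map_pow, map_mul, h2, (permAct_generators hn _).1, hs] at h'
  set H' : MvPolynomial (Fin 4) ℂ := aeval ![X 0, X 2, X 1, -X 3] H
  have g1 : genHom hn (X 1) = beta2 n hn := by simp [genHom]
  have g2 : genHom hn (X 2) = beta3 n hn := by simp [genHom]
  have hndvd : ¬ (X 2 : MvPolynomial (Fin 4) ℂ) ∣ X 1 ^ k := fun hd => by
    simpa [X_dvd_X] using (X_prime (i := (2 : Fin 4))).dvd_of_dvd_pow hd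
  have hdvd : (X 2 : MvPolynomial (Fin 4) ℂ) ^ k ∣ X 1 ^ k * H := by
    refine ⟨-H', genHom_injective hn ?_⟩
    rw [map_mul, map_mul, map_neg, map_pow, map_pow, g1, g2, ← h, ← h']
    ring
  obtain ⟨K, rfl⟩ := (X_prime (i := (2 : Fin 4))).pow_dvd_of_dvd_mul_left k hndvd hdvd
  refine ⟨k, K, mul_left_cancel₀ (pow_ne_zero k (beta3_ne_zero hn)) ?_⟩
  rw [map_mul, map_pow, g2] at h
  rw [← h]
  ring

end Saturation

section Symmetrization

variable {n : ℕ} (hn : 3 ≤ n)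

lemma mul_mem_spanB {g : P n} (h : ∀ i, g * Bsgn n hn i ∈ spanB hn) {s : P n}
    (hs : s ∈ spanB hn) : g * s ∈ spanB hn := by
  induction hs using Submodule.span_induction with
  | mem x hx => obtain ⟨i, rfl⟩ := hx; exact h i
  | zero => rw [mul_zero]; exact zero_mem _
  | add x y _ _ hx hy => rw [mul_add]; exact add_mem hx hy
  | smul c x _ hx => rw [mul_smul_comm]; exact Submodule.smul_mem _ c hx

lemma Bsgn_mem_spanB (i) : Bsgn n hn i ∈ spanB hn := Submodule.subset_span ⟨i, rfl⟩

lemma alpha1_mul_mem {s : P n} (hs : s ∈ spanB hn) : alpha1 n hn * s ∈ spanB hn :=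
  mul_mem_spanB hn (fun i => Bsgn_alphaSucc hn i ▸ Bsgn_mem_spanB hn _) hs

lemma alpha2_mul_mem {s : P n} (hs : s ∈ spanB hn) : alpha2 n hn * s ∈ spanB hn := by
  refine mul_mem_spanB hn ?_ hs
  rintro (⟨a, b, c, d, e⟩ | ⟨a, b, c, d, e⟩)
  · convert Bsgn_mem_spanB hn (Sum.inl (a, b + 1, c, d, e)) using 1
    simp only [Bsgn]; ring
  · convert Bsgn_mem_spanB hn (Sum.inr (a, b + 1, c, d, e)) using 1
    simp only [Bsgn]; ring

lemma alpha1_mul_gamma2 : alpha1 n hn * gamma2 n hn =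
    beta2 n hn * beta3 n hn * (beta2 n hn - beta3 n hn) := by
  simp only [alpha1, gamma2, beta2, beta3, del]; ring

lemma alpha3_sq : alpha3 n hn ^ 2 =
    4 * alpha2 n hn ^ 3 - 27 * (alpha1 n hn ^ 2 * gamma2 n hn ^ 2) := by
  rw [← mul_pow, alpha1_mul_gamma2, alpha2, alpha3]; ring

lemma alpha3_mul_mem {s : P n} (hs : s ∈ spanB hn) : alpha3 n hn * s ∈ spanB hn := by
  refine mul_mem_spanB hn ?_ hs
  have c4 : (C 4 : P n) = 4 := map_ofNat _ 4
  have c27 : (C 27 : P n) = 27 := map_ofNat _ 27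
  rintro (⟨a, b, c, d, e⟩ | ⟨a, b, c, d, e⟩) <;> fin_cases c
  · convert Bsgn_mem_spanB hn (Sum.inl (a, b, 1, d, e)) using 1
    simp [Bsgn]; ring
  · convert sub_mem
      (Submodule.smul_mem _ (4 : ℂ) (Bsgn_mem_spanB hn (Sum.inl (a, b + 3, 0, d, e))))
      (Submodule.smul_mem _ (27 : ℂ) (Bsgn_mem_spanB hn (Sum.inl (a + 2, b, 0, d, e + 1)))) using 1
    simp only [Bsgn, smul_eq_C_mul, c4, c27, Fin.val_zero, pow_one, pow_zero]
    linear_combination (alpha1 n hn ^ a * alpha2 n hn ^ b * gamma1 n hn ^ (2 * d + 1) *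
      gamma2 n hn ^ (2 * e)) * alpha3_sq hn
  · convert Bsgn_mem_spanB hn (Sum.inr (a, b, 1, d, e)) using 1
    simp [Bsgn]; ring
  · convert sub_mem
      (Submodule.smul_mem _ (4 : ℂ) (Bsgn_mem_spanB hn (Sum.inr (a, b + 3, 0, d, e))))
      (Submodule.smul_mem _ (27 : ℂ) (Bsgn_mem_spanB hn (Sum.inr (a + 2, b, 0, d, e + 1)))) using 1
    simp only [Bsgn, smul_eq_C_mul, c4, c27, Fin.val_zero, pow_one, pow_zero]
    linear_combination (alpha1 n hn ^ a * alpha2 n hn ^ b * gamma1 n hn ^ (2 * d) *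
      gamma2 n hn ^ (2 * e + 1)) * alpha3_sq hn

lemma pow_mul_mem_spanB {g : P n} (hg : ∀ s ∈ spanB hn, g * s ∈ spanB hn) (k : ℕ) {s : P n}
    (hs : s ∈ spanB hn) : g ^ k * s ∈ spanB hn := by
  induction k with
  | zero => simpa using hs
  | succ k ih => rw [pow_succ', mul_assoc]; exact hg _ ih

lemma mem_spanB_of_recurrence {x : ℕ → P n} (h0 : x 0 ∈ spanB hn) (h1 : x 1 ∈ spanB hn)
    (h : ∀ k, x (k + 2) = alpha3 n hn * x (k + 1) - alpha2 n hn ^ 3 * x k) (k : ℕ) :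
    x k ∈ spanB hn := by
  suffices x k ∈ spanB hn ∧ x (k + 1) ∈ spanB hn from this.1
  induction k with
  | zero => exact ⟨h0, h1⟩
  | succ k ih =>
    refine ⟨ih.2, ?_⟩
    rw [h]
    exact sub_mem (alpha3_mul_mem hn ih.2)
      (pow_mul_mem_spanB hn (fun _ => alpha2_mul_mem hn) 3 ih.1)

/-- An eigenvector of the three-cycle in the span of `β₂, β₃`. -/
def eigU (ω : ℂ) : P n := beta2 n hn + C ω ^ 2 * beta3 n hn

/-- An eigenvector of the three-cycle in the span of `β₂, β₃`. -/
def eigV (ω : ℂ) : P n := C ω ^ 2 * beta2 n hn + beta3 n hn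

/-- The algebra map sending the four variables to `α₁`, the eigenvectors, and `γ₁`. -/
def eigHom (ω : ℂ) : MvPolynomial (Fin 4) ℂ →ₐ[ℂ] P n :=
  aeval ![alpha1 n hn, eigU hn ω, eigV hn ω, gamma1 n hn]

/-- Antisymmetrization over `S₃`. -/
def antisymmetrize (n : ℕ) : P n →ₗ[ℂ] P n :=
  (LinearMap.id - (permAct n (Equiv.swap 1 2)).toLinearMap) ∘ₗ
    (LinearMap.id + (permAct n (finRotate 3)).toLinearMap +
      (permAct n (finRotate 3)).toLinearMap ∘ₗ (permAct n (finRotate 3)).toLinearMap)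

variable {ω : ℂ}

lemma C_omega (hω : ω ^ 2 + ω + 1 = 0) : (C ω : P n) ^ 2 + C ω + 1 = 0 := by
  rw [← C_1, ← C_pow, ← C_add, ← C_add, hω, C_0]

lemma C_omega_cube (hω : ω ^ 2 + ω + 1 = 0) : (C ω : P n) ^ 3 = 1 := by
  linear_combination (C ω - 1 : P n) * C_omega (n := n) hω

lemma eigU_mul_eigV (hω : ω ^ 2 + ω + 1 = 0) : eigU hn ω * eigV hn ω = C ω ^ 2 * alpha2 n hn := by
  have h := C_omega (n := n) hω
  have h3 := C_omega_cube (n := n) hω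
  simp only [eigU, eigV, alpha2]
  linear_combination (C ω * beta2 n hn * beta3 n hn) * h3 + (beta2 n hn * beta3 n hn) * h

lemma eigU_cube_add (hω : ω ^ 2 + ω + 1 = 0) : eigU hn ω ^ 3 + eigV hn ω ^ 3 = alpha3 n hn := by
  have h := C_omega (n := n) hω
  have h3 := C_omega_cube (n := n) hω
  simp only [eigU, eigV, alpha3]
  linear_combination ((beta2 n hn ^ 3 + beta3 n hn ^ 3) * (C ω ^ 3 + 1) +
    3 * (beta2 n hn * beta3 n hn ^ 2 + beta2 n hn ^ 2 * beta3 n hn) * C ω) * h3 +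
    3 * (beta2 n hn * beta3 n hn ^ 2 + beta2 n hn ^ 2 * beta3 n hn) * h

lemma eigU_cube_sub (hω : ω ^ 2 + ω + 1 = 0) : eigU hn ω ^ 3 - eigV hn ω ^ 3 =
    C (3 * (ω ^ 2 - ω)) * (alpha1 n hn * gamma2 n hn) := by
  have h3 := C_omega_cube (n := n) hω
  have c3 : (C 3 : P n) = 3 := map_ofNat _ 3
  simp only [eigU, eigV, alpha1_mul_gamma2, C_mul, C_sub, C_pow, c3]
  linear_combination ((beta3 n hn ^ 3 - beta2 n hn ^ 3) * (C ω ^ 3 + 1) +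
    3 * (beta2 n hn * beta3 n hn ^ 2 - beta2 n hn ^ 2 * beta3 n hn) * C ω) * h3

lemma power_recurrence (hω : ω ^ 2 + ω + 1 = 0) (ε : P n) (k : ℕ) :
    eigU hn ω ^ (3 * (k + 2)) + ε * eigV hn ω ^ (3 * (k + 2)) =
    alpha3 n hn * (eigU hn ω ^ (3 * (k + 1)) + ε * eigV hn ω ^ (3 * (k + 1))) -
      alpha2 n hn ^ 3 * (eigU hn ω ^ (3 * k) + ε * eigV hn ω ^ (3 * k)) := by
  have h3 := C_omega_cube (n := n) hω
  have h : (eigU hn ω * eigV hn ω) ^ 3 = alpha2 n hn ^ 3 := by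
    rw [eigU_mul_eigV hn hω]
    linear_combination (alpha2 n hn ^ 3 * (C ω ^ 3 + 1)) * h3
  rw [← h, ← eigU_cube_add hn hω]
  ring

lemma cube_powers_mem (hω : ω ^ 2 + ω + 1 = 0) (d k : ℕ) :
    (eigU hn ω ^ (3 * k) + -(-1) ^ d * eigV hn ω ^ (3 * k)) * gamma1 n hn ^ d ∈ spanB hn := by
  refine mem_spanB_of_recurrence hn
    (x := fun k => (eigU hn ω ^ (3 * k) + -(-1) ^ d * eigV hn ω ^ (3 * k)) * gamma1 n hn ^ d)
    ?_ ?_ (fun k => ?_) k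
  · rcases Nat.even_or_odd' d with ⟨e, rfl | rfl⟩
    · simp
    · convert Submodule.smul_mem _ (2 : ℂ) (Bsgn_mem_spanB hn (Sum.inl (0, 0, 0, e, 0))) using 1
      rw [smul_eq_C_mul, show (C 2 : P n) = 2 from map_ofNat _ 2]
      simp only [Bsgn, pow_succ, pow_mul, mul_zero, pow_zero, Fin.val_zero]
      ring
  · rcases Nat.even_or_odd' d with ⟨e, rfl | rfl⟩
    · convert Submodule.smul_mem _ (3 * (ω ^ 2 - ω))
        (alpha1_mul_mem hn (Bsgn_mem_spanB hn (Sum.inr (0, 0, 0, e, 0)))) using 1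
      have := eigU_cube_sub hn hω
      rw [smul_eq_C_mul]
      simp only [Bsgn, pow_mul, neg_one_sq, one_pow, mul_one, mul_zero, zero_add, pow_zero,
        Fin.val_zero, pow_one]
      linear_combination ((gamma1 n hn ^ 2) ^ e) * this
    · convert alpha3_mul_mem hn (Bsgn_mem_spanB hn (Sum.inl (0, 0, 0, e, 0))) using 1
      rw [← eigU_cube_add hn hω]
      simp [Bsgn, pow_succ, pow_mul]
  · simp only [power_recurrence hn hω]; ring

lemma sub_swap_mem_of_le (hω : ω ^ 2 + ω + 1 = 0) (a d : ℕ) {i j k : ℕ} (h : i = j + 3 * k) :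
    alpha1 n hn ^ a * (eigU hn ω ^ i * eigV hn ω ^ j -
      (-1) ^ d * (eigU hn ω ^ j * eigV hn ω ^ i)) * gamma1 n hn ^ d ∈ spanB hn := by
  subst h
  have := Submodule.smul_mem _ ((ω ^ 2) ^ j) (pow_mul_mem_spanB hn (fun _ => alpha1_mul_mem hn) a
    (pow_mul_mem_spanB hn (fun _ => alpha2_mul_mem hn) j (cube_powers_mem hn hω d k)))
  convert this using 1
  rw [smul_eq_C_mul, C_pow, C_pow]
  have h := congrArg (· ^ j) (eigU_mul_eigV hn hω)
  simp only [mul_pow] at h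
  linear_combination (alpha1 n hn ^ a * (eigU hn ω ^ (3 * k) + -(-1) ^ d * eigV hn ω ^ (3 * k)) *
    gamma1 n hn ^ d) * h

lemma sub_swap_mem (hω : ω ^ 2 + ω + 1 = 0) (a d : ℕ) {i j : ℕ} (h : (2 * i + j) % 3 = 0) :
    alpha1 n hn ^ a * (eigU hn ω ^ i * eigV hn ω ^ j -
      (-1) ^ d * (eigU hn ω ^ j * eigV hn ω ^ i)) * gamma1 n hn ^ d ∈ spanB hn := by
  rcases le_total j i with hij | hij
  · exact sub_swap_mem_of_le hn hω a d (k := (i - j) / 3) (by omega)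
  · have := sub_swap_mem_of_le hn hω a d (i := j) (j := i) (k := (j - i) / 3) (by omega)
    rcases neg_one_pow_eq_or (P n) d with hd | hd <;> rw [hd] at this ⊢
    · convert neg_mem this using 1; ring
    · convert this using 1; ring

lemma genHom_mem_range_eigHom (hω : ω ^ 2 + ω + 1 = 0) (H : MvPolynomial (Fin 4) ℂ) :
    genHom hn H ∈ (eigHom hn ω).range := by
  have h := C_omega (n := n) hω
  have h3 := C_omega_cube (n := n) hω
  have hc (f : P n) : f = C (3⁻¹ * (1 - ω ^ 2)) * ((1 - C ω) * f) := by
    have : C (3⁻¹ * (1 - ω ^ 2)) * (1 - C ω) = (1 : P n) := by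
      rw [← C_1, ← C_sub, ← C_mul, show 3⁻¹ * (1 - ω ^ 2) * (1 - ω) = 1 by
        linear_combination (3⁻¹ * (ω - 2)) * hω]
    rw [← mul_assoc, this, one_mul]
  have hC (r : ℂ) : (C r : P n) ∈ (eigHom hn ω).range := Subalgebra.algebraMap_mem _ r
  have hu : eigU hn ω ∈ (eigHom hn ω).range := ⟨X 1, by simp [eigHom]⟩
  have hv : eigV hn ω ∈ (eigHom hn ω).range := ⟨X 2, by simp [eigHom]⟩
  have h2 : beta2 n hn ∈ (eigHom hn ω).range := by
    rw [hc (beta2 n hn), show (1 - C ω) * beta2 n hn = eigU hn ω - C ω ^ 2 * eigV hn ω by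
      simp only [eigU, eigV]; linear_combination (C ω * beta2 n hn) * h3]
    exact mul_mem (hC _) (sub_mem hu (mul_mem (pow_mem (hC _) 2) hv))
  have h4 : beta3 n hn ∈ (eigHom hn ω).range := by
    rw [hc (beta3 n hn), show (1 - C ω) * beta3 n hn = eigV hn ω - C ω ^ 2 * eigU hn ω by
      simp only [eigU, eigV]; linear_combination (C ω * beta3 n hn) * h3]
    exact mul_mem (hC _) (sub_mem hv (mul_mem (pow_mem (hC _) 2) hu))
  induction H using MvPolynomial.induction_on with
  | C r => simpa [genHom] using hC r
  | add p q hp hq => rw [map_add]; exact add_mem hp hq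
  | mul_X p i hp =>
    rw [map_mul]
    refine mul_mem hp ?_
    fin_cases i
    · exact ⟨X 0, by simp [genHom, eigHom]⟩
    · simpa [genHom] using h2
    · simpa [genHom] using h4
    · exact ⟨X 3, by simp [genHom, eigHom]⟩

lemma eigHom_monomial (m : Fin 4 →₀ ℕ) (r : ℂ) :
    eigHom hn ω (monomial m r) = r • (alpha1 n hn ^ m 0 *
      (eigU hn ω ^ m 1 * eigV hn ω ^ m 2) * gamma1 n hn ^ m 3) := by
  rw [eigHom, aeval_monomial, Finsupp.prod_fintype _ _ (by simp), Fin.prod_univ_four,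
    ← Algebra.smul_def]
  exact congrArg (r • ·) (by simp only [Matrix.cons_val, mul_assoc])

lemma permAct_C (σ : Equiv.Perm (Fin 3)) (c : ℂ) : permAct n σ (C c) = C c :=
  (permAct n σ).commutes c

lemma permAct_swap_eig :
    permAct n (Equiv.swap 1 2) (eigU hn ω) = eigV hn ω ∧
    permAct n (Equiv.swap 1 2) (eigV hn ω) = eigU hn ω := by
  obtain ⟨s1, s2, -⟩ := permAct_swap_generators hn
  constructor <;> simp only [eigU, eigV, map_add, map_mul, map_pow, permAct_C, s1, s2] <;> ring

lemma permAct_finRotate_beta :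
    permAct n (finRotate 3) (beta2 n hn) = - beta3 n hn ∧
    permAct n (finRotate 3) (beta3 n hn) = beta2 n hn - beta3 n hn := by
  constructor
  · simp [beta2, beta3, del, permAct_Xe]; ring
  · simp [beta2, beta3, del, permAct_Xe]; ring

lemma permAct_finRotate_eig (hω : ω ^ 2 + ω + 1 = 0) :
    permAct n (finRotate 3) (eigU hn ω) = C ω ^ 2 * eigU hn ω ∧
    permAct n (finRotate 3) (eigV hn ω) = C ω * eigV hn ω := by
  have h := C_omega (n := n) hω
  have h3 := C_omega_cube (n := n) hω
  obtain ⟨r2, r3⟩ := permAct_finRotate_beta hn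
  constructor
  · simp only [eigU, map_add, map_mul, map_pow, permAct_C, r2, r3]
    linear_combination (- C ω * beta3 n hn) * h3 - beta3 n hn * h
  · simp only [eigV, map_add, map_mul, map_pow, permAct_C, r2, r3]
    linear_combination (- beta2 n hn) * h3 - beta3 n hn * h

lemma permAct_finRotate_gamma1 : permAct n (finRotate 3) (gamma1 n hn) = gamma1 n hn := by
  rw [(permAct_generators hn _).2.2.2.1, sign_finRotate]; simp

lemma antisymmetrize_of_eigen {w ζ : P n} (h : permAct n (finRotate 3) w = ζ * w)
    (hζ : permAct n (finRotate 3) ζ = ζ) (hζ' : permAct n (Equiv.swap 1 2) ζ = ζ) :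
    antisymmetrize n w = (1 + ζ + ζ ^ 2) * (w - permAct n (Equiv.swap 1 2) w) := by
  simp only [antisymmetrize, LinearMap.comp_apply, LinearMap.add_apply, LinearMap.sub_apply,
    LinearMap.id_apply, AlgHom.toLinearMap_apply, map_add, map_mul, h, hζ, hζ']
  ring

lemma antisymmetrize_eig_monomial (hω : ω ^ 2 + ω + 1 = 0) (a i j d : ℕ) :
    antisymmetrize n (alpha1 n hn ^ a * (eigU hn ω ^ i * eigV hn ω ^ j) * gamma1 n hn ^ d) =
      (1 + C ω ^ (2 * i + j) + (C ω ^ (2 * i + j)) ^ 2) * (alpha1 n hn ^ a *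
        (eigU hn ω ^ i * eigV hn ω ^ j - (-1) ^ d * (eigU hn ω ^ j * eigV hn ω ^ i)) *
          gamma1 n hn ^ d) := by
  obtain ⟨ru, rv⟩ := permAct_finRotate_eig hn hω
  obtain ⟨su, sv⟩ := permAct_swap_eig hn (ω := ω)
  rw [antisymmetrize_of_eigen (ζ := C ω ^ (2 * i + j))]
  · simp only [map_mul, map_pow, su, sv, (permAct_generators hn _).1,
      (permAct_swap_generators hn).2.2, neg_pow (gamma1 n hn)]
    congr 1
    ring
  · simp only [map_mul, map_pow, ru, rv, permAct_finRotate_gamma1, (permAct_generators hn _).1]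
    ring
  · rw [map_pow, permAct_C]
  · rw [map_pow, permAct_C]

lemma antisymmetrize_eigHom_mem (hω : ω ^ 2 + ω + 1 = 0) (H : MvPolynomial (Fin 4) ℂ) :
    antisymmetrize n (eigHom hn ω H) ∈ spanB hn := by
  have h := C_omega (n := n) hω
  have h3 := C_omega_cube (n := n) hω
  induction H using MvPolynomial.induction_on' with
  | add p q hp hq => rw [map_add, map_add]; exact add_mem hp hq
  | monomial m r =>
    rw [eigHom_monomial, map_smul, antisymmetrize_eig_monomial hn hω]
    refine Submodule.smul_mem _ r ?_
    have hmem := sub_swap_mem hn hω (m 0) (m 3) (i := m 1) (j := m 2)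
    generalize alpha1 n hn ^ m 0 * _ * gamma1 n hn ^ m 3 = s at hmem ⊢
    have hdiv := Nat.div_add_mod (2 * m 1 + m 2) 3
    rw [← hdiv, pow_add, pow_mul, h3, one_pow, one_mul]
    have hlt := Nat.mod_lt (2 * m 1 + m 2) (show 0 < 3 by norm_num)
    generalize (2 * m 1 + m 2) % 3 = q at hlt hmem ⊢
    interval_cases q
    · convert Submodule.smul_mem _ (3 : ℂ) (hmem rfl) using 1
      rw [smul_eq_C_mul, show (C 3 : P n) = 3 from map_ofNat _ 3]
      ring
    · convert zero_mem (spanB hn) using 1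
      linear_combination s * h
    · convert zero_mem (spanB hn) using 1
      linear_combination s * (h + C ω * h3)

end Symmetrization

lemma exists_omega : ∃ ω : ℂ, ω ^ 2 + ω + 1 = 0 := by
  obtain ⟨s, hs⟩ := IsAlgClosed.exists_pow_nat_eq (-3 : ℂ) (n := 2) (by norm_num)
  exact ⟨(-1 + s) / 2, by linear_combination hs / 4⟩

lemma mem_spanB {n : ℕ} (hn : 3 ≤ n) {f : P n} (hf : InQ n f)
    (hs : ∀ σ : Equiv.Perm (Fin 3), permAct n σ f = ((Equiv.Perm.sign σ : ℤ) : ℂ) • f)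
    (hU : UInv n f) : f ∈ spanB hn := by
  obtain ⟨ω, hω⟩ := exists_omega
  have hswap : permAct n (Equiv.swap 1 2) f = -f := by
    simp [hs]
  have hrot : permAct n (finRotate 3) f = f := by
    rw [hs, sign_finRotate]; simp
  obtain ⟨k, H, h⟩ := exists_mul_eq_genHom hn hf hU hswap
  obtain ⟨K, hK⟩ := genHom_mem_range_eigHom hn hω H
  refine mem_spanB_of_alpha1_pow_mul hn k ?_
  have := antisymmetrize_eigHom_mem hn hω K
  change eigHom hn ω K = _ at hK
  rw [hK, ← h] at this
  convert Submodule.smul_mem _ (6⁻¹ : ℂ) this using 1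
  have h6 : antisymmetrize n (alpha1 n hn ^ k * f) = (6 : ℂ) • (alpha1 n hn ^ k * f) := by
    simp only [antisymmetrize, LinearMap.comp_apply, LinearMap.add_apply, LinearMap.sub_apply,
      LinearMap.id_apply, AlgHom.toLinearMap_apply, map_add, map_mul, map_pow, hrot, hswap,
      (permAct_generators hn _).1]
    rw [smul_eq_C_mul, show (C 6 : P n) = 6 from map_ofNat _ 6]
    ring
  rw [h6, inv_smul_smul₀ (by norm_num)]

/-- The set `B_sgn` is a ℂ-basis of `(Q^{sgn})^{U_n}`. -/
theorem stmt_1 (n : ℕ) (hn : 3 ≤ n) :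
    LinearIndependent ℂ (Bsgn n hn) ∧
      (Submodule.span ℂ (Set.range (Bsgn n hn)) : Set (P n)) =
        {f : P n | InQ n f ∧
          (∀ σ : Equiv.Perm (Fin 3), permAct n σ f = ((Equiv.Perm.sign σ : ℤ) : ℂ) • f) ∧
          UInv n f} := by
  refine ⟨linearIndependent_Bsgn hn, Set.Subset.antisymm (fun f hf => ?_) fun f hf =>
    mem_spanB hn hf.1 hf.2.1 hf.2.2⟩
  induction hf using Submodule.span_induction with
  | mem x hx =>
    obtain ⟨i, rfl⟩ := hx
    exact ⟨inQ_Bsgn hn i, fun σ => permAct_Bsgn hn σ i, uInv_Bsgn hn i⟩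
  | zero => exact ⟨by simp [InQ], by simp, fun g _ => map_zero _⟩
  | add x y _ _ hx hy =>
    refine ⟨inQ_iff.2 ((inQ_iff.1 hx.1).add (inQ_iff.1 hy.1)), fun σ => ?_, fun g hg => ?_⟩
    · rw [map_add, hx.2.1, hy.2.1, smul_add]
    · rw [map_add, hx.2.2 g hg, hy.2.2 g hg]
  | smul c x _ hx =>
    refine ⟨inQ_iff.2 ((subalgQ n).smul_mem (inQ_iff.1 hx.1) c), fun σ => ?_, fun g hg => ?_⟩
    · rw [map_smul, hx.2.1, smul_comm]
    · rw [map_smul, hx.2.2 g hg]
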